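/- For every type-B composition α of n, the lattice Tam_B(α) is semidistributive: for all x, y, z ∈ H_α(231), if x ∨ y = x ∨ z then x ∨ y = x ∨ (y ∧ z), and if x ∧ y = x ∧ z then x ∧ y = x ∧ (y ∨ z), where ∨ and ∧ denote the join and meet in Tam_B(α). -/

import Mathlib

namespace TypeB

/-- A sign-symmetric permutation of degree `n`: a bijection of `ℤ` with
`π(-i) = -π(i)` which fixes every integer of absolute value `> n`.
It restricts to a sign-symmetric permutation of `±[n]`. -/
structure SignedPerm (n : ℕ) where
  perm : Equiv.Perm ℤ
  sign_symm : ∀ i : ℤ, perm (-i) = - perm i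
  outside : ∀ i : ℤ, (n : ℤ) < |i| → perm i = i

/-- Symbols for type-B inversions: `neg i` is `[i]`, `pair i j` (with `i < j`)
is `(i,j)`, and `mixed i j` (with `i < j`) is `(−j, i)`. -/
inductive BInv (n : ℕ) : Type where
  | neg : ℕ → BInv n
  | pair : ℕ → ℕ → BInv n
  | mixed : ℕ → ℕ → BInv n
deriving DecidableEq

/-- `i⁺`: `i+1` if `i ≠ -1`, and `1` for `i = -1`. -/
def iplus (i : ℤ) : ℤ := if i = -1 then 1 else i + 1

/-- The inversion set of a sign-symmetric permutation. -/
def Inv {n : ℕ} (π : SignedPerm n) : Set (BInv n) := fun t =>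
  match t with
  | .neg i => 1 ≤ i ∧ i ≤ n ∧ π.perm (i : ℤ) < 0
  | .pair i j => 1 ≤ i ∧ i < j ∧ j ≤ n ∧ π.perm (j : ℤ) < π.perm (i : ℤ)
  | .mixed i j => 1 ≤ i ∧ i < j ∧ j ≤ n ∧ π.perm (i : ℤ) + π.perm (j : ℤ) < 0

/-- The cover-inversion set of a sign-symmetric permutation. -/
def Cov {n : ℕ} (π : SignedPerm n) : Set (BInv n) := fun t =>
  match t with
  | .neg i => 1 ≤ i ∧ i ≤ n ∧ π.perm (i : ℤ) = -1
  | .pair i j => 1 ≤ i ∧ i < j ∧ j ≤ n ∧ π.perm (i : ℤ) = iplus (π.perm (j : ℤ))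
  | .mixed i j => 1 ≤ i ∧ i < j ∧ j ≤ n ∧ π.perm (-(j : ℤ)) = iplus (π.perm (i : ℤ))

/-- The symbol `(−j, i)` in canonical form (it equals `(−i, j)`). -/
def mixedInv {n : ℕ} (i j : ℕ) : BInv n := .mixed (min i j) (max i j)

/-- A type-B composition of `n`: positive parts summing to `n`,
together with a split/join label. -/
structure BComp (n : ℕ) where
  parts : List ℕ
  pos : ∀ a ∈ parts, 0 < a
  sum_eq : parts.sum = n
  isJoin : Bool

/-- The partial sum `p_i = α₁ + ⋯ + α_i`. -/
def pSum {n : ℕ} (α : BComp n) (i : ℕ) : ℕ := (α.parts.take i).sum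

/-- The α-region of `a ∈ [n]`: the unique `i` with `p_{i-1} < a ≤ p_i`. -/
def region {n : ℕ} (α : BComp n) (a : ℕ) : ℕ :=
  ((Finset.range α.parts.length).filter (fun j => pSum α j < a)).card

/-- The first part `α₁` of a type-B composition. -/
def alpha1 {n : ℕ} (α : BComp n) : ℕ := α.parts.headI

/-- Index of the block of `Part(α)` containing `x ∈ ±[n]`; two elements lie in
a common block of `Part(α)` iff their indices agree. -/
def blockIdx {n : ℕ} (α : BComp n) (x : ℤ) : ℤ :=
  if 0 < x then
    (if α.isJoin = true ∧ region α x.toNat = 1 then 0 else (region α x.toNat : ℤ))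
  else
    (if α.isJoin = true ∧ region α (-x).toNat = 1 then 0 else -(region α (-x).toNat : ℤ))

/-- Membership in `±[n]`. -/
def inPM (n : ℕ) (x : ℤ) : Prop := x ≠ 0 ∧ -(n : ℤ) ≤ x ∧ x ≤ (n : ℤ)

/-- `π ∈ H_α`: `π` is increasing on every block of `Part(α)`. -/
def memH {n : ℕ} (α : BComp n) (π : SignedPerm n) : Prop :=
  ∀ a b : ℤ, inPM n a → inPM n b → a < b → blockIdx α a = blockIdx α b →
    π.perm a < π.perm b

/-- Common part of the type-B `(α,231)`- and `(α,312)`-patterns: indices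
`i < j < k` in `±[n]`, in pairwise distinct blocks of `Part(α)`, with `j > 0`
and `π(i) = π(k)⁺`. -/
def patternCore {n : ℕ} (α : BComp n) (π : SignedPerm n) (i j k : ℤ) : Prop :=
  inPM n i ∧ inPM n j ∧ inPM n k ∧ i < j ∧ j < k ∧ 0 < j ∧
  blockIdx α i ≠ blockIdx α j ∧ blockIdx α j ≠ blockIdx α k ∧
  blockIdx α i ≠ blockIdx α k ∧ π.perm i = iplus (π.perm k)

/-- `π` has a type-B `(α,231)`-split (resp. -join) pattern, according to the
label of `α`. -/
def has231 {n : ℕ} (α : BComp n) (π : SignedPerm n) : Prop :=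
  ∃ i j k : ℤ, patternCore α π i j k ∧
    (if α.isJoin = true then
       (((alpha1 α : ℤ) < j → π.perm i < π.perm j) ∧
        (j ≤ (alpha1 α : ℤ) → π.perm j < π.perm k))
     else π.perm i < π.perm j)

/-- `π` has a type-B `(α,312)`-split (resp. -join) pattern, according to the
label of `α`. -/
def has312 {n : ℕ} (α : BComp n) (π : SignedPerm n) : Prop :=
  ∃ i j k : ℤ, patternCore α π i j k ∧
    (if α.isJoin = true then
       (((alpha1 α : ℤ) < j → π.perm j < π.perm k) ∧
        (j ≤ (alpha1 α : ℤ) → π.perm i < π.perm j))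
     else π.perm j < π.perm k)

/-- `π ∈ H_α(231)`. -/
def mem231 {n : ℕ} (α : BComp n) (π : SignedPerm n) : Prop := memH α π ∧ ¬ has231 α π

/-- `π ∈ H_α(312)`. -/
def mem312 {n : ℕ} (α : BComp n) (π : SignedPerm n) : Prop := memH α π ∧ ¬ has312 α π

/-- The set `H_α`. -/
def Hset {n : ℕ} (α : BComp n) : Set (SignedPerm n) := {π | memH α π}

/-- The carrier of `Tam_B(α)`, namely `H_α(231)`. -/
def Tset {n : ℕ} (α : BComp n) : Set (SignedPerm n) := {π | mem231 α π}

/-- The weak order: inclusion of inversion sets. -/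
def wle {n : ℕ} (π σ : SignedPerm n) : Prop := Inv π ⊆ Inv σ

/-- `m` is the greatest lower bound of `x` and `y` within `P`, w.r.t. the weak order. -/
def isMeetIn {n : ℕ} (P : Set (SignedPerm n)) (x y m : SignedPerm n) : Prop :=
  m ∈ P ∧ wle m x ∧ wle m y ∧ ∀ z ∈ P, wle z x → wle z y → wle z m

/-- `u` is the least upper bound of `x` and `y` within `P`, w.r.t. the weak order. -/
def isJoinIn {n : ℕ} (P : Set (SignedPerm n)) (x y u : SignedPerm n) : Prop :=
  u ∈ P ∧ wle x u ∧ wle y u ∧ ∀ z ∈ P, wle x z → wle y z → wle u z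

/-- `d = Π↓(π)`: `d` is the greatest element of `{σ ∈ H_α(231) : Inv σ ⊆ Inv π}`. -/
def isProjDown {n : ℕ} (α : BComp n) (π d : SignedPerm n) : Prop :=
  mem231 α d ∧ wle d π ∧ ∀ σ, mem231 α σ → wle σ π → wle σ d

/-- `d = Π†(π)`: `d` is the greatest element of `{σ ∈ H_α(312) : Inv σ ⊆ Inv π}`. -/
def isProjDagger {n : ℕ} (α : BComp n) (π d : SignedPerm n) : Prop :=
  mem312 α d ∧ wle d π ∧ ∀ σ, mem312 α σ → wle σ π → wle σ d

/-- The value `ω_{o;α}(a)` for `a ∈ [n]`. -/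
def omegaPos {n : ℕ} (α : BComp n) (a : ℕ) : ℤ :=
  if α.isJoin = true ∧ region α a = 1 then (a : ℤ)
  else -(((pSum α (region α a) : ℤ) + (pSum α (region α a - 1) : ℤ) + 1) - (a : ℤ))

/-- The longest element `ω_{o;α}` of `H_α`, as a function on `ℤ`. -/
def omegaFun {n : ℕ} (α : BComp n) (x : ℤ) : ℤ :=
  if 0 < x ∧ x ≤ (n : ℤ) then omegaPos α x.toNat
  else if 0 < -x ∧ -x ≤ (n : ℤ) then -(omegaPos α (-x).toNat)
  else x

/-- The set of `m` such that there is a strict chain `x₀ < x₁ < ⋯ < x_m` in `P`. -/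
def chainLengths {n : ℕ} (P : Set (SignedPerm n)) : Set ℕ :=
  {m | ∃ f : Fin (m + 1) → SignedPerm n, (∀ i, f i ∈ P) ∧
        ∀ i j : Fin (m + 1), i < j → Inv (f i) ⊂ Inv (f j)}

/-- `x` is join-irreducible in `Tam_B(α)`. -/
def joinIrred {n : ℕ} (α : BComp n) (x : SignedPerm n) : Prop :=
  x ∈ Tset α ∧ ¬ (∀ y ∈ Tset α, wle x y) ∧
  ∀ y z, y ∈ Tset α → z ∈ Tset α → isJoinIn (Tset α) y z x → x = y ∨ x = z

/-- `x` is meet-irreducible in `Tam_B(α)`. -/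
def meetIrred {n : ℕ} (α : BComp n) (x : SignedPerm n) : Prop :=
  x ∈ Tset α ∧ ¬ (∀ y ∈ Tset α, wle y x) ∧
  ∀ y z, y ∈ Tset α → z ∈ Tset α → isMeetIn (Tset α) y z x → x = y ∨ x = z

/-- `x` is left modular in the lattice on `P`: `(r ∨ x) ∧ q = r ∨ (x ∧ q)`
for all `r ≤ q` in `P`. -/
def leftModular {n : ℕ} (P : Set (SignedPerm n)) (x : SignedPerm n) : Prop :=
  ∀ r q, r ∈ P → q ∈ P → wle r q →
    ∀ u v w1 w2, isJoinIn P r x u → isMeetIn P u q v →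
      isMeetIn P x q w1 → isJoinIn P r w1 w2 → v = w2

/-- The simple generator `s_i` as a function on `ℤ`: `s₀` exchanges `1` and `-1`,
and for `i ≥ 1`, `s_i` exchanges `i` with `i+1` and `-i` with `-(i+1)`. -/
def sfun (i : ℕ) (x : ℤ) : ℤ :=
  if i = 0 then (if x = 1 then -1 else if x = -1 then 1 else x)
  else if x = (i : ℤ) then (i : ℤ) + 1
  else if x = (i : ℤ) + 1 then (i : ℤ)
  else if x = -(i : ℤ) then -(i : ℤ) - 1
  else if x = -(i : ℤ) - 1 then -(i : ℤ)
  else x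

/-- `i` is one of the partial sums `p₁, …, p_{r−1}` of `α`. -/
def isPSum {n : ℕ} (α : BComp n) (i : ℕ) : Prop :=
  ∃ j : ℕ, 1 ≤ j ∧ j < α.parts.length ∧ pSum α j = i

/-- `n² − Σᵢ α_i(α_i−1)/2`, minus additionally `(α₁+1)α₁/2` when `α` is join. -/
def lengthFormula {n : ℕ} (α : BComp n) : ℕ :=
  n ^ 2 - (α.parts.map (fun a => a * (a - 1) / 2)).sum -
    (if α.isJoin = true then (alpha1 α + 1) * alpha1 α / 2 else 0)

section WeakOrder

open Relation

variable {n : ℕ}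

namespace SignedPerm

theorem perm_zero (π : SignedPerm n) : π.perm 0 = 0 := by
  have := π.sign_symm 0
  simp only [neg_zero] at this
  omega

theorem perm_ne (π : SignedPerm n) {a c : ℤ} (h : a ≠ c) : π.perm a ≠ π.perm c :=
  fun e => h (π.perm.injective e)

theorem perm_mem_Icc (π : SignedPerm n) {a : ℤ} (h₁ : -(n : ℤ) ≤ a) (h₂ : a ≤ n) :
    -(n : ℤ) ≤ π.perm a ∧ π.perm a ≤ n := by
  by_contra h
  have h' : (n : ℤ) < |π.perm a| := by
    rw [lt_abs]; omega
  have := π.perm.injective (π.outside _ h')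
  rw [this, lt_abs] at h'
  omega

theorem perm_of_lt (π : SignedPerm n) {a : ℤ} (h : (n : ℤ) < a) : π.perm a = a :=
  π.outside a (lt_abs.2 (Or.inl h))

theorem perm_of_lt_neg (π : SignedPerm n) {a : ℤ} (h : a < -(n : ℤ)) : π.perm a = a :=
  π.outside a (lt_abs.2 (Or.inr (by omega)))

/-- Inverted pairs of integers have both members in `[-n, n]`. -/
theorem bounds_of_inverted (π : SignedPerm n) {a c : ℤ} (h : a < c)
    (h' : π.perm c < π.perm a) : -(n : ℤ) ≤ a ∧ c ≤ n := by
  constructor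
  · by_contra ha
    have e := π.perm_of_lt_neg (a := a) (by omega)
    by_cases hc : c < -(n : ℤ)
    · have := π.perm_of_lt_neg hc
      omega
    · by_cases hc' : (n : ℤ) < c
      · have := π.perm_of_lt hc'
        omega
      · have := π.perm_mem_Icc (a := c) (by omega) (by omega)
        omega
  · by_contra hc
    have e := π.perm_of_lt (a := c) (by omega)
    by_cases ha : a < -(n : ℤ)
    · have := π.perm_of_lt_neg ha
      omega
    · by_cases ha' : (n : ℤ) < a
      · have := π.perm_of_lt ha'
        omega
      · have := π.perm_mem_Icc (a := a) (by omega) (by omega)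
        omega

/-- The full inversion relation of a sign-symmetric permutation, viewed as a permutation of `ℤ`. -/
def Inverted (π : SignedPerm n) (a c : ℤ) : Prop := a < c ∧ π.perm c < π.perm a

theorem Inverted.trans {π : SignedPerm n} {a b c : ℤ} (h : π.Inverted a b)
    (h' : π.Inverted b c) : π.Inverted a c :=
  ⟨h.1.trans h'.1, h'.2.trans h.2⟩

theorem Inverted.neg {π : SignedPerm n} {a c : ℤ} (h : π.Inverted a c) :
    π.Inverted (-c) (-a) := by
  refine ⟨neg_lt_neg h.1, ?_⟩
  rw [π.sign_symm, π.sign_symm]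
  exact neg_lt_neg h.2

theorem Inverted.left_or_right {π : SignedPerm n} {a b c : ℤ} (h : π.Inverted a c)
    (hab : a < b) (hbc : b < c) : π.Inverted a b ∨ π.Inverted b c := by
  obtain ⟨-, h⟩ := h
  have := π.perm_ne hab.ne
  unfold Inverted
  omega

theorem transGen_inverted {π : SignedPerm n} {R : ℤ → ℤ → Prop}
    (h : ∀ a c, R a c → π.Inverted a c) {a c : ℤ} (hac : TransGen R a c) : π.Inverted a c := by
  induction hac with
  | single h' => exact h _ _ h'
  | tail _ h' ih => exact ih.trans (h _ _ h')

open Classical in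
/-- A transitive and cotransitive relation, symmetric under negation and supported on `[-n, n]`,
is the inversion relation of a sign-symmetric permutation. -/
theorem exists_inverted_iff {R : ℤ → ℤ → Prop} (hlt : ∀ a c, R a c → a < c)
    (hsupp : ∀ a c, R a c → -(n : ℤ) ≤ a ∧ c ≤ n) (hneg : ∀ a c, R a c → R (-c) (-a))
    (htrans : ∀ a b c, R a b → R b c → R a c)
    (hco : ∀ a b c, a < b → b < c → R a c → R a b ∨ R b c) :
    ∃ π : SignedPerm n, ∀ a c, π.Inverted a c ↔ R a c := by
  let prec : ℤ → ℤ → Prop := fun a c => (a < c ∧ ¬ R a c) ∨ R c a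
  have pirr : ∀ a, ¬ prec a a := by
    rintro a (h | h)
    · exact lt_irrefl _ h.1
    · exact lt_irrefl _ (hlt _ _ h)
  have ptot : ∀ a c, a ≠ c → prec a c ∨ prec c a := by
    intro a c h
    simp only [prec]
    rcases lt_or_gt_of_ne h with h | h <;> tauto
  have ptrans : ∀ a b c, prec a b → prec b c → prec a c := by
    intro a b c h₁ h₂
    rcases h₁ with ⟨h₁, h₁'⟩ | h₁ <;> rcases h₂ with ⟨h₂, h₂'⟩ | h₂
    · exact Or.inl ⟨h₁.trans h₂, fun h => (hco _ _ _ h₁ h₂ h).elim h₁' h₂'⟩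
    · rcases lt_trichotomy a c with h | rfl | h
      · exact Or.inl ⟨h, fun h' => h₁' (htrans _ _ _ h' h₂)⟩
      · exact absurd h₂ h₁'
      · exact Or.inr ((hco _ _ _ h h₁ h₂).resolve_right h₁')
    · rcases lt_trichotomy a c with h | rfl | h
      · exact Or.inl ⟨h, fun h' => h₂' (htrans _ _ _ h₁ h')⟩
      · exact absurd h₁ h₂'
      · exact Or.inr ((hco _ _ _ h₂ h h₁).resolve_left h₂')
    · exact Or.inr (htrans _ _ _ h₂ h₁)
  have pasymm : ∀ a c, prec a c → ¬ prec c a := fun a c h h' => pirr _ (ptrans _ _ _ h h')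
  have pneg : ∀ a c, prec a c → prec (-c) (-a) := by
    rintro a c (⟨h, h'⟩ | h)
    · refine Or.inl ⟨neg_lt_neg h, fun h'' => h' ?_⟩
      simpa using hneg _ _ h''
    · exact Or.inr (hneg _ _ h)
  let D : Finset ℤ := Finset.Icc (-(n : ℤ)) n
  have cardD : D.card = 2 * n + 1 := by
    simp only [D, Int.card_Icc]; omega
  let g : ℤ → ℕ := fun a => (D.filter (fun c => prec c a)).card
  have gmono : ∀ a c, a ∈ D → prec a c → g a < g c := by
    intro a c ha h
    refine Finset.card_lt_card ?_
    rw [Finset.ssubset_iff_of_subset]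
    · exact ⟨a, by simp [ha, h], by simp [pirr]⟩
    · intro e he
      simp only [Finset.mem_filter] at he ⊢
      exact ⟨he.1, ptrans _ _ _ he.2 h⟩
  have gneg : ∀ a ∈ D, g a + g (-a) = 2 * n := by
    intro a ha
    have e1 : g (-a) = (D.filter (fun c => prec a c)).card := by
      refine Finset.card_bij (fun c _ => -c) ?_ ?_ ?_
      · intro c hc
        simp only [Finset.mem_filter, D, Finset.mem_Icc] at hc ⊢
        refine ⟨by omega, ?_⟩
        simpa using pneg _ _ hc.2
      · intro c _ c' _ h
        simpa using h
      · intro c hc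
        simp only [Finset.mem_filter, D, Finset.mem_Icc] at hc
        refine ⟨-c, ?_, by simp⟩
        simp only [Finset.mem_filter, D, Finset.mem_Icc]
        exact ⟨by omega, pneg _ _ hc.2⟩
    have e2 : D.filter (fun c => ¬ prec c a) = insert a (D.filter (fun c => prec a c)) := by
      ext c
      simp only [Finset.mem_filter, Finset.mem_insert]
      constructor
      · rintro ⟨h, h'⟩
        by_cases e : c = a
        · exact Or.inl e
        · exact Or.inr ⟨h, (ptot _ _ e).resolve_left h'⟩
      · rintro (rfl | h)
        · exact ⟨ha, pirr _⟩
        · exact ⟨h.1, pasymm _ _ h.2⟩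
    have e3 := Finset.card_filter_add_card_filter_not (s := D) (fun c => prec c a)
    rw [e2, Finset.card_insert_of_notMem (by simp [pirr]), cardD, ← e1] at e3
    simp only [g] at e3 ⊢
    omega
  let f : ℤ → ℤ := fun a => if a ∈ D then (g a : ℤ) - n else a
  have fin : ∀ a, a ∈ D → f a = (g a : ℤ) - n := fun a h => if_pos h
  have fout : ∀ a, a ∉ D → f a = a := fun a h => if_neg h
  have fmem : ∀ a, a ∈ D → f a ∈ D := by
    intro a ha
    have := gneg a ha
    rw [fin a ha]
    simp only [D, Finset.mem_Icc]
    omega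
  have fmono : ∀ a c, prec a c → f a < f c := by
    intro a c h
    by_cases ha : a ∈ D <;> by_cases hc : c ∈ D
    · rw [fin a ha, fin c hc]
      have := gmono a c ha h
      omega
    · have := fmem a ha
      rw [fout c hc]
      simp only [D, Finset.mem_Icc] at this ha hc
      rcases h with h | h
      · omega
      · have := hsupp _ _ h
        have := hlt _ _ h
        omega
    · have := fmem c hc
      rw [fout a ha]
      simp only [D, Finset.mem_Icc] at this ha hc
      rcases h with h | h
      · omega
      · have := hsupp _ _ h
        have := hlt _ _ h
        omega
    · rw [fout a ha, fout c hc]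
      simp only [D, Finset.mem_Icc] at ha hc
      rcases h with h | h
      · exact h.1
      · have := hsupp _ _ h
        have := hlt _ _ h
        omega
  have finj : Function.Injective f := by
    intro a c h
    by_contra hne
    rcases ptot _ _ hne with h' | h' <;> have := fmono _ _ h' <;> omega
  have fsurj : Function.Surjective f := by
    intro c
    by_cases hc : c ∈ D
    · have : D.image f = D := by
        refine Finset.eq_of_subset_of_card_le ?_ ?_
        · intro x hx
          obtain ⟨a, ha, rfl⟩ := Finset.mem_image.1 hx
          exact fmem a ha
        · rw [Finset.card_image_of_injective _ finj]
      rw [← this] at hc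
      obtain ⟨a, -, ha⟩ := Finset.mem_image.1 hc
      exact ⟨a, ha⟩
    · exact ⟨c, fout c hc⟩
  have fbij : Function.Bijective f := ⟨finj, fsurj⟩
  refine ⟨⟨Equiv.ofBijective f fbij, ?_, ?_⟩, ?_⟩
  · intro a
    simp only [Equiv.ofBijective_apply]
    by_cases ha : a ∈ D
    · have ha' : -a ∈ D := by
        simp only [D, Finset.mem_Icc] at ha ⊢; omega
      have := gneg a ha
      rw [fin _ ha, fin _ ha']
      omega
    · have ha' : -a ∉ D := by
        simp only [D, Finset.mem_Icc] at ha ⊢; omega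
      rw [fout _ ha, fout _ ha']
  · intro a ha
    simp only [Equiv.ofBijective_apply]
    refine fout a fun h => ?_
    simp only [D, Finset.mem_Icc] at h
    rw [lt_abs] at ha
    omega
  · intro a c
    simp only [Inverted, Equiv.ofBijective_apply]
    constructor
    · rintro ⟨h, h'⟩
      by_contra hR
      have := fmono a c (Or.inl ⟨h, hR⟩)
      omega
    · intro h
      exact ⟨hlt _ _ h, fmono _ _ (Or.inr h)⟩

/-- The transitive closure of a cotransitive relation, symmetric under negation and supported on
`[-n, n]`, is the inversion relation of a sign-symmetric permutation. -/
theorem exists_inverted_iff_transGen {R : ℤ → ℤ → Prop} (hlt : ∀ a c, R a c → a < c)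
    (hsupp : ∀ a c, R a c → -(n : ℤ) ≤ a ∧ c ≤ n) (hneg : ∀ a c, R a c → R (-c) (-a))
    (hco : ∀ a b c, a < b → b < c → R a c → R a b ∨ R b c) :
    ∃ π : SignedPerm n, ∀ a c, π.Inverted a c ↔ TransGen R a c := by
  have tlt : ∀ a c, TransGen R a c → a < c := by
    intro a c h
    induction h with
    | single h => exact hlt _ _ h
    | tail _ h ih => exact ih.trans (hlt _ _ h)
  refine exists_inverted_iff tlt ?_ ?_ (fun _ _ _ => TransGen.trans) ?_
  · intro a c h
    induction h with
    | single h => exact hsupp _ _ h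
    | tail _ h ih => exact ⟨ih.1, (hsupp _ _ h).2⟩
  · intro a c h
    induction h with
    | single h => exact .single (hneg _ _ h)
    | tail _ h ih => exact .head (hneg _ _ h) ih
  · intro a b c hab hbc h
    induction h with
    | single h => exact (hco _ _ _ hab hbc h).imp .single .single
    | @tail d e h h' ih =>
      rcases lt_trichotomy b d with hbd | rfl | hbd
      · exact (ih hbd).imp id (fun h => h.tail h')
      · exact Or.inl h
      · exact (hco _ _ _ hbd hbc h').imp (fun h'' => h.tail h'') .single

/-- Existence of joins in the weak order. -/
theorem exists_sup (S : Set (SignedPerm n)) :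
    ∃ v : SignedPerm n, ∀ a c,
      v.Inverted a c ↔ TransGen (fun a c => ∃ π ∈ S, π.Inverted a c) a c := by
  refine exists_inverted_iff_transGen ?_ ?_ ?_ ?_
  · rintro a c ⟨π, -, h⟩
    exact h.1
  · rintro a c ⟨π, -, h⟩
    exact π.bounds_of_inverted h.1 h.2
  · rintro a c ⟨π, hπ, h⟩
    exact ⟨π, hπ, h.neg⟩
  · rintro a b c hab hbc ⟨π, hπ, h⟩
    exact (h.left_or_right hab hbc).imp (fun h => ⟨π, hπ, h⟩) (fun h => ⟨π, hπ, h⟩)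

/-- Existence of meets in the weak order. -/
theorem exists_inf {S : Set (SignedPerm n)} (hS : S.Nonempty) :
    ∃ v : SignedPerm n, ∀ a c, v.Inverted a c ↔
      a < c ∧ ¬ TransGen (fun a c => a < c ∧ ∃ π ∈ S, π.perm a < π.perm c) a c := by
  set N : ℤ → ℤ → Prop := fun a c => a < c ∧ ∃ π ∈ S, π.perm a < π.perm c with hN
  refine exists_inverted_iff (fun _ _ h => h.1) ?_ ?_ ?_ ?_
  · rintro a c ⟨hac, h⟩
    obtain ⟨π, hπ⟩ := hS
    have : ¬ π.perm a < π.perm c := fun h' => h (.single ⟨hac, π, hπ, h'⟩)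
    have := π.perm_ne hac.ne
    exact π.bounds_of_inverted hac (by omega)
  · rintro a c ⟨hac, h⟩
    refine ⟨neg_lt_neg hac, fun h' => h ?_⟩
    have key : ∀ a c, TransGen N a c → TransGen N (-c) (-a) := by
      intro a c h
      have step : ∀ a c, N a c → N (-c) (-a) := by
        rintro a c ⟨h, π, hπ, h'⟩
        refine ⟨neg_lt_neg h, π, hπ, ?_⟩
        rw [π.sign_symm, π.sign_symm]
        exact neg_lt_neg h'
      induction h with
      | single h => exact .single (step _ _ h)
      | tail _ h ih => exact .head (step _ _ h) ih
    simpa using key _ _ h'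
  · rintro a b c ⟨hab, h⟩ ⟨hbc, h'⟩
    refine ⟨hab.trans hbc, fun h'' => ?_⟩
    have key : ∀ a c, TransGen N a c → ∀ b, a < b → b < c →
        TransGen N a b ∨ TransGen N b c := by
      intro a c h
      have step : ∀ a b c, a < b → b < c → N a c → N a b ∨ N b c := by
        rintro a b c hab hbc ⟨-, π, hπ, h⟩
        by_cases h' : π.perm a < π.perm b
        · exact Or.inl ⟨hab, π, hπ, h'⟩
        · exact Or.inr ⟨hbc, π, hπ, by omega⟩
      induction h with
      | single h =>
        intro b hab hbc
        exact (step _ _ _ hab hbc h).imp .single .single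
      | @tail d e h h' ih =>
        intro b hab hbc
        rcases lt_trichotomy b d with hbd | rfl | hbd
        · exact (ih b hab hbd).imp id (fun h => h.tail h')
        · exact Or.inl h
        · exact (step _ _ _ hbd hbc h').imp (fun h'' => h.tail h'') .single
    exact (key _ _ h'' b hab hbc).elim h h'
  · rintro a b c hab hbc ⟨hac, h⟩
    by_contra hcon
    simp only [not_or, not_and, not_not] at hcon
    exact h ((hcon.1 hab).trans (hcon.2 hbc))

end SignedPerm

end WeakOrder

section Aligned

open Relation SignedPerm

variable {n : ℕ} {b : ℤ → ℤ} {P : ℤ → Prop}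

/-- Weak order, expressed through the full inversion relation. -/
def Below (π σ : SignedPerm n) : Prop := ∀ a c, π.Inverted a c → σ.Inverted a c

/-- `π` increases on every fibre of `b`. -/
def IncrOn (b : ℤ → ℤ) (π : SignedPerm n) : Prop :=
  ∀ a c, a < c → b a = b c → π.perm a < π.perm c

/-- At a descent in consecutive values, the positions in `P` lying in blocks strictly in between
carry smaller values. -/
def Aligned (b : ℤ → ℤ) (P : ℤ → Prop) (π : SignedPerm n) : Prop :=
  IncrOn b π ∧ ∀ i j k, b i < b j → b j < b k → π.perm i = π.perm k + 1 → P j →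
    π.perm j < π.perm k

/-- The counterpart of `Aligned` for ascents in consecutive values, characterizing the top elements
of the classes whose bottom elements are aligned. -/
def CoAligned (b : ℤ → ℤ) (P : ℤ → Prop) (π : SignedPerm n) : Prop :=
  IncrOn b π ∧ ∀ i j k : ℤ, -(n : ℤ) ≤ i → k ≤ n → b i < b j → b j < b k →
    π.perm k = π.perm i + 1 → P j → π.perm j < π.perm i

theorem Below.trans {x y z : SignedPerm n} (h : Below x y) (h' : Below y z) : Below x z :=
  fun a c hac => h' a c (h a c hac)

theorem IncrOn.of_below {x y : SignedPerm n} (hy : IncrOn b y) (h : Below x y) : IncrOn b x := by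
  intro a c hac hb
  by_contra hx
  have := x.perm_ne hac.ne
  have := (h a c ⟨hac, by omega⟩).2
  have := hy a c hac hb
  omega

theorem Below.lt_of_lt {x y : SignedPerm n} (h : Below x y) {a c : ℤ} (hac : a < c)
    (hy : y.perm a < y.perm c) : x.perm a < x.perm c := by
  by_contra hx
  have := x.perm_ne hac.ne
  have := (h a c ⟨hac, by omega⟩).2
  omega

theorem rel_of_transGen_of_adjacent {R : ℤ → ℤ → Prop} {f : ℤ → ℤ}
    (hf : ∀ a c, R a c → f a < f c) {i k : ℤ} (hik : f k = f i + 1) (h : TransGen R i k) :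
    R i k := by
  have mono : ∀ a c, TransGen R a c → f a < f c := by
    intro a c h
    induction h with
    | single h => exact hf _ _ h
    | tail _ h ih => exact ih.trans (hf _ _ h)
  obtain ⟨q, hq, hq'⟩ := TransGen.head'_iff.1 h
  rcases Relation.reflTransGen_iff_eq_or_transGen.1 hq' with rfl | hq'
  · exact hq
  · have := hf _ _ hq
    have := mono _ _ hq'
    omega

theorem exists_crossing (Q : ℤ → Prop) {lo hi : ℤ} (h : lo ≤ hi) (hlo : Q lo) (hhi : ¬ Q hi) :
    ∃ c, lo ≤ c ∧ c < hi ∧ Q c ∧ ¬ Q (c + 1) := by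
  by_contra hcon
  push Not at hcon
  have key : ∀ m, lo ≤ m → m ≤ hi → Q m := by
    intro m hm
    induction m, hm using Int.leInduction with
    | base => exact fun _ => hlo
    | succ m hm ih => exact fun h' => hcon m hm (by omega) (ih (by omega))
  exact hhi (key hi h le_rfl)

theorem perm_lt_of_below (hb : Monotone b) {x v : SignedPerm n} (hx : Aligned b P x)
    (hxv : Below x v) {i j k : ℤ} (hik : x.Inverted i k) (hv : v.perm i = v.perm k + 1)
    (hij : b i < b j) (hjk : b j < b k) (hP : P j) : v.perm j < v.perm k := by
  by_contra hcon
  have hij' := hb.reflect_lt hij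
  have hjk' := hb.reflect_lt hjk
  have h₁ := v.perm_ne hij'.ne
  have h₂ := v.perm_ne hjk'.ne
  have h₃ := hxv.lt_of_lt hij' (by omega)
  obtain ⟨c, hc₁, hc₂, hc₃, hc₄⟩ := exists_crossing (fun c => b j < b (x.perm.symm c)) hik.2.le
    (by simpa using hjk) (by simpa using hij.le)
  simp only [not_lt] at hc₄
  obtain ⟨k', rfl⟩ := x.perm.surjective c
  obtain ⟨i', hi'⟩ := x.perm.surjective (x.perm k' + 1)
  rw [← hi'] at hc₄
  simp only [Equiv.symm_apply_apply] at hc₃ hc₄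
  rcases hc₄.lt_or_eq with hc₄ | hc₄
  · have := hx.2 i' j k' hc₄ hc₃ hi' hP
    omega
  · have h₄ : i < i' := hb.reflect_lt (by omega)
    have h₅ : i' < k := hb.reflect_lt (by omega)
    have h₆ := x.perm_ne h₄.ne
    have h₇ := (hxv i i' ⟨h₄, by omega⟩).2
    have h₈ := (hxv i' k ⟨h₅, by omega⟩).2
    omega

theorem perm_lt_of_above (hb : Monotone b) {z v : SignedPerm n} (hz : CoAligned b P z)
    (hvz : Below v z) {i j k : ℤ} (hi : -(n : ℤ) ≤ i) (hk : k ≤ n) (hik : z.perm i < z.perm k)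
    (hv : v.perm k = v.perm i + 1)
    (hij : b i < b j) (hjk : b j < b k) (hP : P j) : v.perm j < v.perm i := by
  by_contra hcon
  have hij' := hb.reflect_lt hij
  have hjk' := hb.reflect_lt hjk
  have h₁ := v.perm_ne hij'.ne
  have h₂ := v.perm_ne hjk'.ne
  have h₃ := (hvz j k ⟨hjk', by omega⟩).2
  obtain ⟨c, hc₁, hc₂, hc₃, hc₄⟩ := exists_crossing (fun c => b (z.perm.symm c) < b j) hik.le
    (by simpa using hij) (by simpa using hjk.le)
  simp only [not_lt] at hc₄
  obtain ⟨i', rfl⟩ := z.perm.surjective c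
  obtain ⟨k', hk'⟩ := z.perm.surjective (z.perm i' + 1)
  rw [← hk'] at hc₄
  simp only [Equiv.symm_apply_apply] at hc₃ hc₄
  have hzi := z.perm_mem_Icc hi (by omega)
  have hzk := z.perm_mem_Icc (a := k) (by omega) hk
  rcases hc₄.lt_or_eq with hc₄ | hc₄
  · have hi₁ : -(n : ℤ) ≤ i' := by
      by_contra h
      have := z.perm_of_lt_neg (a := i') (by omega)
      omega
    have hk₁ : k' ≤ n := by
      by_contra h
      have := z.perm_of_lt (a := k') (by omega)
      omega
    have := hz.2 i' j k' hi₁ hk₁ hc₃ hc₄ hk' hP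
    omega
  · have h₄ : i < k' := hb.reflect_lt (by omega)
    have h₅ : k' < k := hb.reflect_lt (by omega)
    have h₆ := z.perm_ne h₅.ne
    have h₇ := hvz.lt_of_lt h₄ (by omega)
    have h₈ := hvz.lt_of_lt h₅ (by omega)
    omega

/-- The inversions forced, below or just above `u`, by an inversion at the adjacent pair `(i, k)`. -/
def Forced (u : SignedPerm n) (i k a c : ℤ) : Prop :=
  i ≤ a ∧ a < c ∧ c ≤ k ∧ (a = i ∨ (u.perm i < u.perm a ∧ u.perm k < u.perm a)) ∧
    (c = k ∨ (u.perm c < u.perm i ∧ u.perm c < u.perm k))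

theorem Forced.neg {u : SignedPerm n} {i k a c : ℤ} (h : Forced u i k a c) :
    Forced u (-k) (-i) (-c) (-a) := by
  simp only [Forced, u.sign_symm] at h ⊢
  omega

theorem Forced.left_or_right {u : SignedPerm n} {i k a c d : ℤ}
    (hu : u.perm i = u.perm k + 1 ∨ u.perm k = u.perm i + 1) (h : Forced u i k a d)
    (hac : a < c) (hcd : c < d) : Forced u i k a c ∨ Forced u i k c d := by
  unfold Forced at h ⊢
  have := u.perm_ne (a := c) (c := i) (by omega)
  have := u.perm_ne (a := c) (c := k) (by omega)
  omega

/-- An inversion at an adjacent pair `(i, k)` is witnessed by a least aligned permutation. -/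
theorem exists_aligned_of_adjacent (hb : Monotone b) (hbneg : ∀ a, b (-a) = - b a)
    {u : SignedPerm n} (hu : IncrOn b u) {i k : ℤ} (hik : b i < b k) (hi : -(n : ℤ) ≤ i)
    (hk : k ≤ n) (hadj : u.perm i = u.perm k + 1 ∨ u.perm k = u.perm i + 1)
    (hP : ∀ p, P p → b i < b p → b p < b k → u.perm p < u.perm i ∧ u.perm p < u.perm k)
    (hP' : ∀ p, P p → b (-k) < b p → b p < b (-i) →
      u.perm p < u.perm (-k) ∧ u.perm p < u.perm (-i)) :
    ∃ w : SignedPerm n, Aligned b P w ∧ ∀ a c, w.Inverted a c ↔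
      TransGen (fun a c => Forced u i k a c ∨ Forced u (-k) (-i) a c) a c := by
  have hadj' : u.perm (-k) = u.perm (-i) + 1 ∨ u.perm (-i) = u.perm (-k) + 1 := by
    simp only [u.sign_symm]; omega
  have hik' : b (-k) < b (-i) := by rw [hbneg, hbneg]; omega
  obtain ⟨w, hw⟩ := exists_inverted_iff_transGen (n := n)
    (R := fun a c => Forced u i k a c ∨ Forced u (-k) (-i) a c)
    (by rintro a c (h | h) <;> exact h.2.1)
    (by rintro a c (h | h) <;> unfold Forced at h <;> omega)
    (by
      rintro a c (h | h)
      · exact Or.inr h.neg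
      · exact Or.inl (by simpa using h.neg))
    (by
      rintro a c d hac hcd (h | h)
      · exact (h.left_or_right hadj hac hcd).imp Or.inl Or.inl
      · exact (h.left_or_right hadj' hac hcd).imp Or.inr Or.inr)
  have block : ∀ i k, b i < b k → ∀ a c, Forced u i k a c → b a < b c := by
    intro i k hik a c h
    refine lt_of_le_of_ne (hb h.2.1.le) fun e => ?_
    have := hu a c h.2.1 e
    obtain ⟨h₁, h₂, h₃, h₄ | h₄, h₅ | h₅⟩ := h
    · subst h₄ h₅; omega
    · subst h₄; omega
    · subst h₅; omega
    · omega
  have small : ∀ i k, (∀ p, P p → b i < b p → b p < b k →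
      u.perm p < u.perm i ∧ u.perm p < u.perm k) → ∀ a c p, Forced u i k a c →
      b a < b p → b p < b c → P p → Forced u i k a p := by
    intro i k hP a c p h hap hpc hp
    obtain ⟨h₁, h₂, h₃, h₄, h₅⟩ := h
    have h₆ := hb.reflect_lt hap
    have h₇ := hb.reflect_lt hpc
    have h₈ := hP p hp ((hb h₁).trans_lt hap) (hpc.trans_le (hb h₃))
    exact ⟨h₁, h₆, by omega, h₄, Or.inr h₈⟩
  refine ⟨w, ⟨?_, ?_⟩, hw⟩
  · intro a c hac e
    by_contra hcon
    have h₀ := w.perm_ne hac.ne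
    have h := (hw a c).1 ⟨hac, by omega⟩
    have : ∀ a c, TransGen (fun a c => Forced u i k a c ∨ Forced u (-k) (-i) a c) a c →
        b a < b c := by
      have step : ∀ a c, (Forced u i k a c ∨ Forced u (-k) (-i) a c) → b a < b c := by
        rintro a c (h | h)
        · exact block _ _ hik _ _ h
        · exact block _ _ hik' _ _ h
      intro a c h
      induction h with
      | single h => exact step _ _ h
      | tail _ h ih => exact ih.trans (step _ _ h)
    have := this a c h
    omega
  · intro i' p k' hip hpk hval hp
    have hip' := hb.reflect_lt hip
    have hpk' := hb.reflect_lt hpk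
    have h := (hw i' k').1 ⟨by omega, by omega⟩
    have h₁ : Forced u i k i' k' ∨ Forced u (-k) (-i) i' k' := by
      refine rel_of_transGen_of_adjacent (f := fun a => -w.perm a) (fun a c hac => ?_)
        (by omega) h
      exact neg_lt_neg ((hw a c).2 (.single hac)).2
    have h₂ : w.Inverted i' p := by
      refine (hw _ _).2 (.single ?_)
      exact h₁.imp (fun h => small _ _ hP _ _ _ h hip hpk hp)
        (fun h => small _ _ hP' _ _ _ h hip hpk hp)
    have := h₂.2
    have := w.perm_ne hpk'.ne
    omega

theorem forced_inverted_of_below {u y : SignedPerm n} (h : Below y u) {i k : ℤ}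
    (hu : u.perm i = u.perm k + 1) (hy : y.Inverted i k) {a c : ℤ} (hf : Forced u i k a c) :
    y.Inverted a c := by
  obtain ⟨h₁, h₂, h₃, h₄, h₅⟩ := hf
  have h₆ : y.perm i ≤ y.perm a := by
    rcases h₄ with rfl | h₄
    · exact le_rfl
    · rcases h₁.eq_or_lt with rfl | h₁
      · exact le_rfl
      · exact (h.lt_of_lt h₁ h₄.1).le
  have h₇ : y.perm c ≤ y.perm k := by
    rcases h₅ with rfl | h₅
    · exact le_rfl
    · rcases h₃.eq_or_lt with rfl | h₃
      · exact le_rfl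
      · exact (h.lt_of_lt h₃ h₅.2).le
  exact ⟨h₂, by have := hy.2; omega⟩

theorem forced_inverted_of_above {v y : SignedPerm n} (h : Below v y) {i k : ℤ}
    (hy : y.Inverted i k) {a c : ℤ} (hf : Forced v i k a c) : y.Inverted a c := by
  obtain ⟨h₁, h₂, h₃, rfl | h₄, rfl | h₅⟩ := hf
  · exact hy
  · exact h _ _ ⟨h₂, h₅.1⟩
  · exact h _ _ ⟨h₂, h₄.2⟩
  · exact h _ _ ⟨h₂, by omega⟩

/-- A permutation is below every upper bound of the relations forced by its descents. -/
theorem below_of_forced {u w : SignedPerm n}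
    (h : ∀ i k, i < k → u.perm i = u.perm k + 1 → ∀ a c, Forced u i k a c → w.Inverted a c) :
    Below u w := by
  have key : ∀ m : ℕ, ∀ a c, u.Inverted a c → u.perm a - u.perm c ≤ m → w.Inverted a c := by
    intro m
    induction m with
    | zero => intro a c h h'; have := h.2; omega
    | succ m ih =>
      intro a c hac hm
      by_cases hmid : ∃ p, a < p ∧ p < c ∧ u.perm c < u.perm p ∧ u.perm p < u.perm a
      · obtain ⟨p, h₁, h₂, h₃, h₄⟩ := hmid
        exact (ih a p ⟨h₁, h₄⟩ (by omega)).trans (ih p c ⟨h₂, h₃⟩ (by omega))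
      · push Not at hmid
        obtain ⟨d, hd₁, hd₂, hd₃, hd₄⟩ := exists_crossing (fun d => c ≤ u.perm.symm d) hac.2.le
          (by simp) (by simpa using hac.1)
        obtain ⟨k, rfl⟩ := u.perm.surjective d
        obtain ⟨i, hi⟩ := u.perm.surjective (u.perm k + 1)
        rw [← hi] at hd₄
        simp only [Equiv.symm_apply_apply, not_le] at hd₃ hd₄
        have hia : i ≤ a := by
          by_contra hia
          have := hmid i (by omega) hd₄ (by omega)
          have := u.perm_ne (a := i) (c := a) (by omega)
          omega
        have hac' := hac.1
        refine h i k (by omega) hi a c ⟨hia, hac.1, hd₃, ?_, ?_⟩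
        · rcases eq_or_ne a i with e | e
          · exact Or.inl e
          · have := u.perm_ne e
            omega
        · rcases eq_or_ne c k with e | e
          · exact Or.inl e
          · have := u.perm_ne e
            omega
  intro a c hac
  have := hac.2
  exact key (u.perm a - u.perm c).toNat a c hac (by omega)

/-- A permutation increasing on blocks is below `v` as soon as it avoids the pairs whose
non-inversion is forced by the ascents of `v`. -/
theorem below_of_forced_ascents (hb : Monotone b) {v x : SignedPerm n} (hx : IncrOn b x)
    (h : ∀ i k : ℤ, -(n : ℤ) ≤ i → k ≤ n → b i < b k → v.perm k = v.perm i + 1 → ∀ a c, i ≤ a →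
      a < c → c ≤ k → v.perm a ≤ v.perm i → v.perm k ≤ v.perm c → x.perm a < x.perm c) :
    Below x v := by
  have key : ∀ m : ℕ, ∀ a c, a < c → v.perm a < v.perm c → v.perm c - v.perm a ≤ m →
      x.perm a < x.perm c := by
    intro m
    induction m with
    | zero => intro a c _ h h'; omega
    | succ m ih =>
      intro a c hac hval hm
      by_cases hrange : -(n : ℤ) ≤ a ∧ c ≤ n
      swap
      · by_contra hcon
        have := x.perm_ne hac.ne
        exact hrange (x.bounds_of_inverted hac (by omega))
      obtain ⟨hra, hrc⟩ := hrange
      by_cases hbe : b a = b c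
      · exact hx a c hac hbe
      by_cases hmid : ∃ p, a < p ∧ p < c ∧ v.perm a < v.perm p ∧ v.perm p < v.perm c
      · obtain ⟨p, h₁, h₂, h₃, h₄⟩ := hmid
        exact (ih a p h₁ h₃ (by omega)).trans (ih p c h₂ h₄ (by omega))
      · push Not at hmid
        obtain ⟨d, hd₁, hd₂, hd₃, hd₄⟩ := exists_crossing (fun d => v.perm.symm d ≤ a) hval.le
          (by simp) (by simpa using hac)
        obtain ⟨i, rfl⟩ := v.perm.surjective d
        obtain ⟨k, hk⟩ := v.perm.surjective (v.perm i + 1)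
        rw [← hk] at hd₄
        simp only [Equiv.symm_apply_apply, not_le] at hd₃ hd₄
        have hkc : c ≤ k := by
          by_contra hkc
          have := hmid k hd₄ (by omega) (by omega)
          have := v.perm_ne (a := k) (c := c) (by omega)
          omega
        have hva := v.perm_mem_Icc (a := a) hra (by omega)
        have hvc := v.perm_mem_Icc (a := c) (by omega) hrc
        have hi₁ : -(n : ℤ) ≤ i := by
          by_contra h
          have := v.perm_of_lt_neg (a := i) (by omega)
          omega
        have hk₁ : k ≤ n := by
          by_contra h
          have := v.perm_of_lt (a := k) (by omega)
          omega
        have := hb hd₃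
        have := hb hkc
        have := hb hac.le
        exact h i k hi₁ hk₁ (by omega) hk a c hd₃ hac hkc hd₁ (by omega)
  intro a c hac
  refine ⟨hac.1, ?_⟩
  by_contra hcon
  have := v.perm_ne hac.1.ne
  have := hac.2
  have := key (v.perm c - v.perm a).toNat a c hac.1 (by omega) (by omega)
  omega


/-- The sign-symmetric involution of `ℤ` exchanging the consecutive values `d` and `d + 1`. -/
def swapVal (d x : ℤ) : ℤ :=
  if d = 0 ∨ d = -1 then (if x = 1 then -1 else if x = -1 then 1 else x)
  else if x = d then d + 1 else if x = d + 1 then d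
  else if x = -d then -d - 1 else if x = -d - 1 then -d else x

theorem swapVal_involutive (d : ℤ) : Function.Involutive (swapVal d) := by
  intro x
  unfold swapVal
  grind

theorem swapVal_neg (d x : ℤ) : swapVal d (-x) = - swapVal d x := by
  unfold swapVal
  grind

/-- Exchanging the consecutive values at an ascent creates only the evident inversions. -/
theorem exists_swap (v : SignedPerm n) {i k : ℤ} (hi : -(n : ℤ) ≤ i) (hk : k ≤ n) (hik : i < k)
    (hv : v.perm k = v.perm i + 1) :
    ∃ v' : SignedPerm n, Below v v' ∧ v'.perm i = v'.perm k + 1 ∧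
      (∀ p, i < p → p < k → v.perm k < v.perm p → v'.perm k < v'.perm p) ∧
      ∀ a c, v'.Inverted a c → v.Inverted a c ∨ (a = i ∧ c = k) ∨ (a = -k ∧ c = -i) ∨
        (c = -a ∧ ((i = 0 ∧ c = k) ∨ (k = 0 ∧ a = i))) := by
  have position : ∀ a, (v.perm a = v.perm i → a = i) ∧ (v.perm a = v.perm k → a = k) ∧
      (v.perm a = -v.perm i → a = -i) ∧ (v.perm a = -v.perm k → a = -k) ∧
      (v.perm a = 0 → a = 0) := by
    intro a
    rw [← v.sign_symm, ← v.sign_symm]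
    exact ⟨fun h => v.perm.injective h, fun h => v.perm.injective h,
      fun h => v.perm.injective h, fun h => v.perm.injective h,
      fun h => v.perm.injective (h.trans v.perm_zero.symm)⟩
  have hi₀ := position 0
  have hvi := v.perm_mem_Icc hi (by omega)
  have hvk := v.perm_mem_Icc (a := k) (by omega) hk
  have hv₀ := v.perm_zero
  refine ⟨⟨v.perm.trans (swapVal_involutive (v.perm i)).toPerm, ?_, ?_⟩, ?_, ?_, ?_, ?_⟩
  · intro a
    simp [v.sign_symm, swapVal_neg]
  · intro a ha
    have := v.outside a ha
    rw [lt_abs] at ha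
    simp only [Equiv.trans_apply, Function.Involutive.coe_toPerm, this]
    unfold swapVal
    grind (splits := 40)
  · intro a c h
    obtain ⟨hac, h⟩ := h
    refine ⟨hac, ?_⟩
    have ha := position a
    have hc := position c
    simp only [Equiv.trans_apply, Function.Involutive.coe_toPerm]
    unfold swapVal
    grind (splits := 40)
  · simp only [Equiv.trans_apply, Function.Involutive.coe_toPerm]
    unfold swapVal
    grind (splits := 40)
  · intro p hip hpk h
    have hp := position p
    simp only [Equiv.trans_apply, Function.Involutive.coe_toPerm]
    unfold swapVal
    grind (splits := 40)
  · intro a c h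
    obtain ⟨hac, h⟩ := h
    have ha := position a
    have hc := position c
    simp only [Equiv.trans_apply, Function.Involutive.coe_toPerm] at h
    unfold swapVal at h
    unfold Inverted
    grind (splits := 40)

theorem exists_coAligned_of_aligned (hb : Monotone b) (hbneg : ∀ a, b (-a) = - b a)
    {x : SignedPerm n} (hx : Aligned b P x) :
    ∃ v, CoAligned b P v ∧ Below x v ∧ ∀ a, Aligned b P a → Below a v → Below a x := by
  classical
  let D : Finset (ℤ × ℤ) := Finset.Icc (-(n : ℤ)) n ×ˢ Finset.Icc (-(n : ℤ)) n
  let μ : SignedPerm n → ℕ := fun v => (D.filter (fun p => v.Inverted p.1 p.2)).card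
  have hb₀ : b 0 = 0 := by have := hbneg 0; simp only [neg_zero] at this; omega
  have key : ∀ m : ℕ, ∀ v : SignedPerm n, D.card - μ v ≤ m → IncrOn b v → Below x v →
      (∀ a, Aligned b P a → Below a v → Below a x) →
      ∃ v, CoAligned b P v ∧ Below x v ∧ ∀ a, Aligned b P a → Below a v → Below a x := by
    intro m
    induction m with
    | zero | succ m ih =>
      intro v hm hinc hxv hD
      by_cases hco : CoAligned b P v
      · exact ⟨v, hco, hxv, hD⟩
      have hpat : ∃ i j k : ℤ, -(n : ℤ) ≤ i ∧ k ≤ n ∧ b i < b j ∧ b j < b k ∧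
          v.perm k = v.perm i + 1 ∧ P j ∧ v.perm i ≤ v.perm j := by
        by_contra hcon
        refine hco ⟨hinc, fun i j k h₁ h₂ h₃ h₄ h₅ h₆ => ?_⟩
        by_contra h₇
        exact hcon ⟨i, j, k, h₁, h₂, h₃, h₄, h₅, h₆, by omega⟩
      obtain ⟨i, j, k, hi, hk, hij, hjk, hval, hp, hle⟩ := hpat
      have hij' := hb.reflect_lt hij
      have hjk' := hb.reflect_lt hjk
      have h₁ := v.perm_ne hij'.ne
      have h₂ := v.perm_ne hjk'.ne
      obtain ⟨v', hvv', hval', hup, hnew⟩ := exists_swap v hi hk (hij'.trans hjk') hval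
      have hμ : μ v < μ v' := by
        refine Finset.card_lt_card ((Finset.ssubset_iff_of_subset ?_).2 ⟨(i, k), ?_, ?_⟩)
        · intro p hp
          simp only [Finset.mem_filter] at hp ⊢
          exact ⟨hp.1, hvv' _ _ hp.2⟩
        · exact Finset.mem_filter.2 ⟨Finset.mem_product.2 ⟨Finset.mem_Icc.2
            ⟨hi, show i ≤ n by omega⟩, Finset.mem_Icc.2 ⟨show -(n : ℤ) ≤ k by omega, hk⟩⟩,
            hij'.trans hjk', show v'.perm k < v'.perm i by omega⟩
        · intro h
          have : v.perm k < v.perm i := (Finset.mem_filter.1 h).2.2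
          omega
      have hμD : μ v' ≤ D.card := Finset.card_filter_le _ _
      have step : IncrOn b v' ∧ ∀ a, Aligned b P a → Below a v' → Below a x := by
        refine ⟨?_, ?_⟩
        · intro a c hac e
          by_contra hcon
          have := v'.perm_ne hac.ne
          have hkeep := hinc a c hac e
          have hbi := hbneg i
          have hbk := hbneg k
          have hba := hbneg a
          rcases hnew a c ⟨hac, by omega⟩ with h | ⟨rfl, rfl⟩ | ⟨rfl, rfl⟩ |
            ⟨rfl, ⟨rfl, rfl⟩ | ⟨rfl, rfl⟩⟩
          · have := h.2
            omega
          all_goals omega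
        · intro a ha hav'
          by_cases hik : a.Inverted i k
          · have := perm_lt_of_below hb ha hav' hik hval' hij hjk hp
            have := hup j hij' hjk' (by omega)
            omega
          · refine hD a ha fun s t hst => ?_
            rcases hnew s t (hav' s t hst) with h | ⟨rfl, rfl⟩ | ⟨rfl, rfl⟩ |
              ⟨rfl, ⟨rfl, rfl⟩ | ⟨rfl, rfl⟩⟩
            · exact h
            · exact absurd hst hik
            · exact absurd (by simpa using hst.neg) hik
            · have h := hst.2
              have h₀ := a.perm_zero
              have h₁ := a.sign_symm s
              exact absurd ⟨by omega, by omega⟩ hik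
            · have h := hst.2
              have h₀ := a.perm_zero
              have h₁ := a.sign_symm s
              exact absurd ⟨by omega, by omega⟩ hik
      first
        | exact ih v' (by omega) step.1 (hxv.trans hvv') step.2
        | omega
  exact key _ x le_rfl hx.1 (fun _ _ h => h) (fun _ _ h => h)

theorem aligned_sup (hb : Monotone b) {S : Set (SignedPerm n)} (hS : ∀ π ∈ S, Aligned b P π)
    {v : SignedPerm n}
    (hv : ∀ a c, v.Inverted a c ↔ TransGen (fun a c => ∃ π ∈ S, π.Inverted a c) a c) :
    Aligned b P v := by
  have below : ∀ π ∈ S, Below π v := fun π hπ a c h => (hv a c).2 (.single ⟨π, hπ, h⟩)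
  refine ⟨?_, ?_⟩
  · intro a c hac e
    by_contra hcon
    have := v.perm_ne hac.ne
    obtain ⟨q, ⟨π, hπ, hq⟩, hq'⟩ := TransGen.head'_iff.1 ((hv a c).1 ⟨hac, by omega⟩)
    have hqc : q ≤ c := by
      rcases Relation.reflTransGen_iff_eq_or_transGen.1 hq' with rfl | hq'
      · exact le_rfl
      · exact ((hv _ _).2 hq').1.le
    have := (hS π hπ).1 a q hq.1 (le_antisymm (hb hq.1.le) (e ▸ hb hqc))
    have := hq.2
    omega
  · intro i j k hij hjk hval hp
    have hij' := hb.reflect_lt hij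
    have hjk' := hb.reflect_lt hjk
    obtain ⟨π, hπ, h⟩ := rel_of_transGen_of_adjacent (f := fun a => -v.perm a)
      (fun a c hac => neg_lt_neg ((hv a c).2 (.single hac)).2) (by omega)
      ((hv i k).1 ⟨by omega, by omega⟩)
    exact perm_lt_of_below hb (hS π hπ) (below π hπ) h hval hij hjk hp

theorem aligned_sup_meet_le (hb : Monotone b) (hbneg : ∀ a, b (-a) = - b a)
    {x y z u m w : SignedPerm n}
    (hx : Aligned b P x) (hy : Aligned b P y) (hz : Aligned b P z) (hu : Aligned b P u)
    (hxu : Below x u) (hyu : Below y u) (hzu : Below z u)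
    (hxy : ∀ v, Aligned b P v → Below x v → Below y v → Below u v)
    (hxz : ∀ v, Aligned b P v → Below x v → Below z v → Below u v)
    (hm : ∀ v, Aligned b P v → Below v y → Below v z → Below v m)
    (hxw : Below x w) (hmw : Below m w) : Below u w := by
  have cover : ∀ y, Aligned b P y → Below y u →
      (∀ v, Aligned b P v → Below x v → Below y v → Below u v) →
      ∀ i k, i < k → u.perm i = u.perm k + 1 → x.Inverted i k ∨ y.Inverted i k := by
    intro y hy hyu hxy i k hik hval
    obtain ⟨v, hv⟩ := exists_sup ({x, y} : Set (SignedPerm n))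
    have hva : Aligned b P v := aligned_sup hb (by rintro π (rfl | rfl) <;> assumption) hv
    have huv := hxy v hva (fun a c h => (hv a c).2 (.single ⟨x, by simp, h⟩))
      (fun a c h => (hv a c).2 (.single ⟨y, by simp, h⟩))
    obtain ⟨π, rfl | rfl, h⟩ := rel_of_transGen_of_adjacent (f := fun a => -u.perm a)
      (fun a c ⟨π, hπ, h⟩ => neg_lt_neg (by
        rcases hπ with rfl | rfl
        · exact (hxu a c h).2
        · exact (hyu a c h).2))
      (by omega) ((hv i k).1 (huv i k ⟨hik, by omega⟩))
    · exact Or.inl h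
    · exact Or.inr h
  refine below_of_forced fun i k hik hval => ?_
  have hval' : u.perm (-k) = u.perm (-i) + 1 := by
    simp only [u.sign_symm]; omega
  have hbik : b i < b k := by
    refine lt_of_le_of_ne (hb hik.le) fun e => ?_
    have := hu.1 i k hik e
    omega
  have hrange := u.bounds_of_inverted hik (by omega)
  obtain ⟨j, hj, hj'⟩ := exists_aligned_of_adjacent hb hbneg hu.1 hbik hrange.1 hrange.2
    (Or.inl hval) (fun p hp h h' => by have := hu.2 i p k h h' hval hp; omega)
    (fun p hp h h' => by have := hu.2 _ p _ h h' hval' hp; omega)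
  have jle : ∀ y, Below y u → y.Inverted i k → Below j y := by
    intro y hyu hik a c h
    refine transGen_inverted ?_ ((hj' a c).1 h)
    rintro a c (h | h)
    · exact forced_inverted_of_below hyu hval hik h
    · exact forced_inverted_of_below hyu hval' hik.neg h
  have hjw : Below j w := by
    rcases cover y hy hyu hxy i k hik hval with h | h
    · exact (jle x hxu h).trans hxw
    · rcases cover z hz hzu hxz i k hik hval with h' | h'
      · exact (jle x hxu h').trans hxw
      · exact (hm j hj (jle y hyu h) (jle z hzu h')).trans hmw
  exact fun a c h => hjw a c ((hj' a c).2 (.single (Or.inl h)))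

theorem aligned_le_inf (hb : Monotone b) (hbneg : ∀ a, b (-a) = - b a)
    {x y z u m w : SignedPerm n}
    (hx : Aligned b P x) (hy : Aligned b P y) (hz : Aligned b P z) (hw : Aligned b P w)
    (hux : Below u x) (huy : Below u y) (huz : Below u z)
    (hxy : ∀ v, Aligned b P v → Below v x → Below v y → Below v u)
    (hxz : ∀ v, Aligned b P v → Below v x → Below v z → Below v u)
    (hm : ∀ v, Aligned b P v → Below y v → Below z v → Below m v)
    (hwx : Below w x) (hwm : Below w m) : Below w u := by
  obtain ⟨x', hx', hxx', hxD⟩ := exists_coAligned_of_aligned hb hbneg hx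
  obtain ⟨y', hy', hyy', hyD⟩ := exists_coAligned_of_aligned hb hbneg hy
  obtain ⟨z', hz', hzz', hzD⟩ := exists_coAligned_of_aligned hb hbneg hz
  obtain ⟨v, hv⟩ := exists_inf (S := ({x', y', z'} : Set (SignedPerm n))) ⟨x', by simp⟩
  have vle : ∀ π ∈ ({x', y', z'} : Set (SignedPerm n)), Below v π := by
    intro π hπ a c h
    refine ⟨h.1, ?_⟩
    by_contra hcon
    have := π.perm_ne h.1.ne
    exact ((hv a c).1 h).2 (.single ⟨h.1, π, hπ, by omega⟩)
  have hvx : Below v x' := vle x' (by simp)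
  have hvy : Below v y' := vle y' (by simp)
  have hvz : Below v z' := vle z' (by simp)
  have huv : Below u v := by
    intro a c h
    refine (hv a c).2 ⟨h.1, fun h' => ?_⟩
    have : u.perm a < u.perm c := by
      have step : ∀ a c, (a < c ∧ ∃ π ∈ ({x', y', z'} : Set (SignedPerm n)),
          π.perm a < π.perm c) → u.perm a < u.perm c := by
        rintro a c ⟨hac, π, rfl | rfl | rfl, h⟩
        · exact (hux.trans hxx').lt_of_lt hac h
        · exact (huy.trans hyy').lt_of_lt hac h
        · exact (huz.trans hzz').lt_of_lt hac h
      clear h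
      induction h' with
      | single h => exact step _ _ h
      | tail _ h ih => exact ih.trans (step _ _ h)
    have := h.2
    omega
  have vD : ∀ a, Aligned b P a → Below a v → Below a u := fun a ha hav =>
    hxy a ha (hxD a ha (hav.trans hvx)) (hyD a ha (hav.trans hvy))
  refine vD w hw (below_of_forced_ascents hb hw.1 ?_)
  intro i k hi hk hbik hval a c hia hac hck hva hvc
  by_contra hcon
  have hik := hb.reflect_lt hbik
  have hwac : w.Inverted a c := ⟨hac, by have := w.perm_ne hac.ne; omega⟩
  -- an element above `v` inverting `(a, c)` inverts `(i, k)`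
  have forced : ∀ q, Below v q → q.Inverted a c → q.Inverted i k := by
    intro q hvq hq
    refine ⟨hik, ?_⟩
    by_contra hcon
    have h₁ := q.perm_ne hik.ne
    have h₂ : q.perm a ≤ q.perm i := by
      rcases hia.eq_or_lt with rfl | hia
      · exact le_rfl
      · have := v.perm_ne hia.ne
        exact (hvq i a ⟨hia, by omega⟩).2.le
    have h₃ : q.perm k ≤ q.perm c := by
      rcases hck.eq_or_lt with rfl | hck
      · exact le_rfl
      · have := v.perm_ne hck.ne
        exact (hvq c k ⟨hck, by omega⟩).2.le
    have := hq.2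
    omega
  have hxik := forced x' hvx (hxx' _ _ (hwx _ _ hwac))
  have hval' : v.perm (-i) = v.perm (-k) + 1 := by
    simp only [v.sign_symm]; omega
  have hbik' : b (-k) < b (-i) := by rw [hbneg, hbneg]; omega
  -- some member of the meet does not invert `(i, k)`
  have free : ∀ i k : ℤ, -(n : ℤ) ≤ i → k ≤ n → b i < b k → v.perm k = v.perm i + 1 →
      ∀ p, P p → b i < b p → b p < b k → v.perm p < v.perm i ∧ v.perm p < v.perm k := by
    intro i k hi hk hbik hval p hp h₁ h₂
    have hik := hb.reflect_lt hbik
    have hnot : ¬ v.Inverted i k := fun h => by have := h.2; omega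
    rw [hv] at hnot
    push Not at hnot
    obtain ⟨-, π, hπ, h⟩ := rel_of_transGen_of_adjacent (f := v.perm)
      (fun a c ⟨hac, π, hπ, h⟩ => (vle π hπ).lt_of_lt hac h) hval (hnot hik)
    have hπ' : CoAligned b P π := by
      rcases hπ with rfl | rfl | rfl <;> assumption
    have := perm_lt_of_above hb hπ' (vle π hπ) hi hk h hval h₁ h₂ hp
    omega
  obtain ⟨j, hj, hj'⟩ := exists_aligned_of_adjacent hb hbneg (hx'.1.of_below hvx) hbik hi hk
    (Or.inr hval) (free i k hi hk hbik hval)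
    (free (-k) (-i) (by omega) (by omega) hbik' hval')
  have jle : ∀ y, Below v y → y.Inverted i k → Below j y := by
    intro y hvy hik a c h
    refine transGen_inverted ?_ ((hj' a c).1 h)
    rintro a c (h | h)
    · exact forced_inverted_of_above hvy hik h
    · exact forced_inverted_of_above hvy hik.neg h
  have jnot : ¬ Below j u := by
    intro hju
    have : Forced v i k i k := ⟨le_rfl, hik, le_rfl, Or.inl rfl, Or.inl rfl⟩
    have := (huv _ _ (hju _ _ ((hj' _ _).2 (.single (Or.inl this))))).2
    omega
  have hjx := hxD j hj (jle x' hvx hxik)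
  have hyik : ¬ y'.Inverted i k := fun h => jnot (hxy j hj hjx (hyD j hj (jle y' hvy h)))
  have hzik : ¬ z'.Inverted i k := fun h => jnot (hxz j hj hjx (hzD j hj (jle z' hvz h)))
  obtain ⟨q, hq⟩ := exists_sup ({y', z'} : Set (SignedPerm n))
  have hyq : Below y' q := fun a c h => (hq a c).2 (.single ⟨y', by simp, h⟩)
  have hzq : Below z' q := fun a c h => (hq a c).2 (.single ⟨z', by simp, h⟩)
  have hmq : Below m q := by
    obtain ⟨s, hs⟩ := exists_sup ({y, z} : Set (SignedPerm n))
    refine (hm s (aligned_sup hb (by rintro π (rfl | rfl) <;> assumption) hs)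
      (fun a c h => (hs a c).2 (.single ⟨y, by simp, h⟩))
      (fun a c h => (hs a c).2 (.single ⟨z, by simp, h⟩))).trans fun a c h => ?_
    refine transGen_inverted ?_ ((hs a c).1 h)
    rintro a c ⟨π, rfl | rfl, h⟩
    · exact hyq _ _ (hyy' _ _ h)
    · exact hzq _ _ (hzz' _ _ h)
  have hqik := forced q (hvy.trans hyq) (hmq _ _ (hwm _ _ hwac))
  -- the first step of a chain of inversions towards `k` stays inverted in `v`
  have stays : ∀ π, Below v π → ¬ π.Inverted i k → ∀ p, p ≤ k → π.Inverted i p →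
      v.Inverted i p := by
    intro π hvπ hπ p hpk hp
    rcases hpk.eq_or_lt with rfl | hpk
    · exact absurd hp hπ
    · have h₁ : v.perm p < v.perm k := hvπ.lt_of_lt hpk (by
        by_contra h
        have := π.perm_ne hpk.ne
        exact hπ (hp.trans ⟨hpk, by omega⟩))
      have h₂ := v.perm_ne hp.1.ne
      exact ⟨hp.1, by omega⟩
  have chain : ∀ p, TransGen (fun a c => ∃ π ∈ ({y', z'} : Set (SignedPerm n)),
      π.Inverted a c) i p → p ≤ k → v.Inverted i p := by
    intro p h
    induction h with
    | single h =>
      intro hpk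
      obtain ⟨π, rfl | rfl, h⟩ := h
      · exact stays _ hvy hyik _ hpk h
      · exact stays _ hvz hzik _ hpk h
    | tail _ h ih =>
      intro hpk
      obtain ⟨π, rfl | rfl, h⟩ := h
      · exact stays _ hvy hyik _ hpk ((hvy _ _ (ih (h.1.le.trans hpk))).trans h)
      · exact stays _ hvz hzik _ hpk ((hvz _ _ (ih (h.1.le.trans hpk))).trans h)
  have := (chain k ((hq i k).1 hqik) le_rfl).2
  omega

end Aligned

section Translation

open SignedPerm

variable {n : ℕ}

theorem wle_iff_below (π σ : SignedPerm n) : wle π σ ↔ Below π σ := by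
  constructor
  · intro h a c hac
    obtain ⟨hlt, hinv⟩ := hac
    obtain ⟨ha, hc⟩ := π.bounds_of_inverted hlt hinv
    refine ⟨hlt, ?_⟩
    have hneg : ∀ i : ℕ, 1 ≤ i → i ≤ n → π.perm i < 0 → σ.perm i < 0 := fun i h₁ h₂ h₃ =>
      (@h (.neg i) ⟨h₁, h₂, h₃⟩).2.2
    have hpair : ∀ i j : ℕ, 1 ≤ i → i < j → j ≤ n → π.perm j < π.perm i →
        σ.perm j < σ.perm i := fun i j h₁ h₂ h₃ h₄ =>
      (@h (.pair i j) ⟨h₁, h₂, h₃, h₄⟩).2.2.2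
    have hmixed : ∀ i j : ℕ, 1 ≤ i → i < j → j ≤ n → π.perm i + π.perm j < 0 →
        σ.perm i + σ.perm j < 0 := fun i j h₁ h₂ h₃ h₄ =>
      (@h (.mixed i j) ⟨h₁, h₂, h₃, h₄⟩).2.2.2
    have π₀ := π.perm_zero
    have σ₀ := σ.perm_zero
    rcases lt_trichotomy a 0 with ha₀ | rfl | ha₀
    · obtain ⟨i, rfl⟩ : ∃ i : ℕ, a = -(i : ℤ) := ⟨(-a).toNat, by omega⟩
      rw [π.sign_symm] at hinv
      rw [σ.sign_symm]
      rcases lt_trichotomy c 0 with hc₀ | rfl | hc₀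
      · obtain ⟨j, rfl⟩ : ∃ j : ℕ, c = -(j : ℤ) := ⟨(-c).toNat, by omega⟩
        rw [π.sign_symm] at hinv
        rw [σ.sign_symm]
        have := hpair j i (by omega) (by omega) (by omega) (by omega)
        omega
      · have := hneg i (by omega) (by omega) (by omega)
        omega
      · obtain ⟨j, rfl⟩ : ∃ j : ℕ, c = (j : ℤ) := ⟨c.toNat, by omega⟩
        rcases lt_trichotomy i j with hij | rfl | hij
        · have := hmixed i j (by omega) hij (by omega) (by omega)
          omega
        · have := hneg i (by omega) (by omega) (by omega)
          omega
        · have := hmixed j i (by omega) hij (by omega) (by omega)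
          omega
    · obtain ⟨j, rfl⟩ : ∃ j : ℕ, c = (j : ℤ) := ⟨c.toNat, by omega⟩
      have := hneg j (by omega) (by omega) (by omega)
      omega
    · obtain ⟨i, rfl⟩ : ∃ i : ℕ, a = (i : ℤ) := ⟨a.toNat, by omega⟩
      obtain ⟨j, rfl⟩ : ∃ j : ℕ, c = (j : ℤ) := ⟨c.toNat, by omega⟩
      exact hpair i j (by omega) (by omega) (by omega) hinv
  · rintro h (i | ⟨i, j⟩ | ⟨i, j⟩) ht
    · obtain ⟨h₁, h₂, h₃⟩ := ht
      have := (h 0 i ⟨by omega, by rw [π.perm_zero]; exact h₃⟩).2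
      rw [σ.perm_zero] at this
      exact ⟨h₁, h₂, this⟩
    · obtain ⟨h₁, h₂, h₃, h₄⟩ := ht
      exact ⟨h₁, h₂, h₃, (h i j ⟨by omega, h₄⟩).2⟩
    · obtain ⟨h₁, h₂, h₃, h₄⟩ := ht
      have := (h (-(i : ℤ)) j ⟨by omega, by rw [π.sign_symm]; omega⟩).2
      rw [σ.sign_symm] at this
      exact ⟨h₁, h₂, h₃, by omega⟩

theorem region_mono (α : BComp n) : Monotone (region α) := by
  intro a c h
  refine Finset.card_le_card fun i hi => ?_
  simp only [Finset.mem_filter] at hi ⊢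
  exact ⟨hi.1, hi.2.trans_le h⟩

theorem parts_length_pos (hn : 1 ≤ n) (α : BComp n) : 0 < α.parts.length := by
  rw [List.length_pos_iff]
  intro h
  have := α.sum_eq
  simp [h] at this
  omega

theorem region_pos (hn : 1 ≤ n) (α : BComp n) {a : ℕ} (ha : 0 < a) : 0 < region α a := by
  refine Finset.card_pos.2 ⟨0, ?_⟩
  simp only [Finset.mem_filter, Finset.mem_range]
  exact ⟨parts_length_pos hn α, by simpa [pSum] using ha⟩

theorem region_zero (α : BComp n) : region α 0 = 0 := by
  simp [region]

theorem pSum_one (α : BComp n) : pSum α 1 = alpha1 α := by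
  unfold pSum alpha1
  cases α.parts <;> simp

theorem region_eq_one_iff (hn : 1 ≤ n) (α : BComp n) {a : ℕ} (ha : 0 < a) (han : a ≤ n) :
    region α a = 1 ↔ a ≤ alpha1 α := by
  have hlen := parts_length_pos hn α
  have h₀ : pSum α 0 = 0 := by simp [pSum]
  have h₁ := pSum_one α
  constructor
  · intro h
    by_contra hlt
    have hlen₂ : 1 < α.parts.length := by
      by_contra hlen₂
      have : pSum α 1 = n := by
        rw [pSum, List.take_of_length_le (by omega), α.sum_eq]
      omega
    have : ({0, 1} : Finset ℕ) ⊆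
        (Finset.range α.parts.length).filter (fun j => pSum α j < a) := by
      intro i hi
      simp only [Finset.mem_insert, Finset.mem_singleton] at hi
      simp only [Finset.mem_filter, Finset.mem_range]
      rcases hi with rfl | rfl <;> omega
    have := Finset.card_le_card this
    simp only [region] at h
    simp at this
    omega
  · intro h
    have : (Finset.range α.parts.length).filter (fun j => pSum α j < a) = {0} := by
      ext i
      simp only [Finset.mem_filter, Finset.mem_range, Finset.mem_singleton]
      constructor
      · rintro ⟨-, hi⟩
        by_contra hne
        have : pSum α 1 ≤ pSum α i :=
          List.Sublist.sum_le_sum (List.take_sublist_take_left (by omega)) (by simp)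
        omega
      · rintro rfl
        omega
    simp [region, this]

theorem blockIdx_neg (α : BComp n) (x : ℤ) : blockIdx α (-x) = -blockIdx α x := by
  unfold blockIdx
  rcases lt_trichotomy x 0 with h | rfl | h
  · have h₁ : 0 < -x := by omega
    have h₂ : ¬ 0 < x := by omega
    rw [if_pos h₁, if_neg h₂]
    split_ifs <;> simp
  · simp [region_zero]
  · have h₁ : ¬ 0 < -x := by omega
    rw [if_neg h₁, if_pos h]
    simp only [neg_neg]
    split_ifs <;> simp

theorem blockIdx_zero (α : BComp n) : blockIdx α 0 = 0 := by
  have := blockIdx_neg α 0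
  simp only [neg_zero] at this
  omega

theorem blockIdx_nonneg (α : BComp n) {x : ℤ} (hx : 0 ≤ x) : 0 ≤ blockIdx α x := by
  rcases hx.eq_or_lt with rfl | hx
  · rw [blockIdx_zero]
  · unfold blockIdx
    rw [if_pos hx]
    split_ifs <;> simp

theorem blockIdx_mono (hn : 1 ≤ n) (α : BComp n) : Monotone (blockIdx α) := by
  have pos : ∀ x y : ℤ, 0 ≤ x → x ≤ y → blockIdx α x ≤ blockIdx α y := by
    intro x y hx hxy
    rcases hx.eq_or_lt with rfl | hx
    · rw [blockIdx_zero]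
      exact blockIdx_nonneg α hxy
    · have h₁ := region_mono α (Int.toNat_le_toNat hxy)
      have h₂ := region_pos hn α (a := x.toNat) (by omega)
      unfold blockIdx
      rw [if_pos hx, if_pos (hx.trans_le hxy)]
      split_ifs with h h' h'
      · exact le_rfl
      · omega
      · exact absurd ⟨h'.1, by omega⟩ h
      · omega
  intro x y hxy
  rcases le_total 0 x with hx | hx
  · exact pos x y hx hxy
  · rcases le_total 0 y with hy | hy
    · have h₁ := blockIdx_nonneg α hy
      have h₂ := blockIdx_nonneg α (x := -x) (by omega)
      rw [blockIdx_neg] at h₂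
      omega
    · have h := pos (-y) (-x) (by omega) (by omega)
      rw [blockIdx_neg, blockIdx_neg] at h
      omega

theorem blockIdx_eq_zero_iff (hn : 1 ≤ n) (α : BComp n) {x : ℤ} (hx : 0 < x) (hxn : x ≤ n) :
    blockIdx α x = 0 ↔ α.isJoin = true ∧ x ≤ alpha1 α := by
  have h₁ := region_pos hn α (a := x.toNat) (by omega)
  have h₂ := region_eq_one_iff hn α (a := x.toNat) (by omega) (by omega)
  unfold blockIdx
  rw [if_pos hx]
  split_ifs with h
  · simp only [true_iff]
    exact ⟨h.1, by have := h₂.1 h.2; omega⟩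
  · constructor
    · intro h'
      omega
    · intro h'
      exact absurd ⟨h'.1, h₂.2 (by omega)⟩ h

theorem memH_iff_incrOn (hn : 1 ≤ n) (α : BComp n) (π : SignedPerm n) :
    memH α π ↔ IncrOn (blockIdx α) π := by
  constructor
  · intro h a c hac e
    by_contra hcon
    have hne := π.perm_ne hac.ne
    obtain ⟨ha, hc⟩ := π.bounds_of_inverted hac (by omega)
    have π₀ := π.perm_zero
    by_cases ha₀ : a = 0
    · subst ha₀
      have hm := h (-c) c ⟨by omega, by omega, by omega⟩ ⟨by omega, by omega, by omega⟩
        (by omega) (by rw [blockIdx_neg, ← e, blockIdx_zero]; rfl)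
      rw [π.sign_symm] at hm
      omega
    · by_cases hc₀ : c = 0
      · subst hc₀
        have hm := h a (-a) ⟨by omega, by omega, by omega⟩ ⟨by omega, by omega, by omega⟩
          (by omega) (by rw [blockIdx_neg, e, blockIdx_zero]; rfl)
        rw [π.sign_symm] at hm
        omega
      · exact hcon (h a c ⟨ha₀, by omega, by omega⟩ ⟨hc₀, by omega, by omega⟩ hac e)
  · intro h a c _ _ hac e
    exact h a c hac e

/-- The positions at which the `(α,231)`-condition forbids large values. -/
def upperPos (α : BComp n) (j : ℤ) : Prop := 0 < blockIdx α j ∨ (blockIdx α j = 0 ∧ j < 0)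

theorem mem231_iff_aligned (hn : 1 ≤ n) (α : BComp n) (π : SignedPerm n) :
    mem231 α π ↔ Aligned (blockIdx α) (upperPos α) π := by
  have hb := blockIdx_mono hn α
  have hb₀ := blockIdx_zero α
  have π₀ := π.perm_zero
  unfold mem231 Aligned
  rw [memH_iff_incrOn hn]
  refine and_congr_right fun hinc => ?_
  constructor
  · intro h i j k hij hjk hval hp
    by_contra hcon
    have hij' := hb.reflect_lt hij
    have hjk' := hb.reflect_lt hjk
    have h₁ := π.perm_ne hij'.ne
    have h₂ := π.perm_ne hjk'.ne
    obtain ⟨hi, hk⟩ := π.bounds_of_inverted (hij'.trans hjk') (by omega)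
    have hni := blockIdx_neg α i
    have hnj := blockIdx_neg α j
    have hnk := blockIdx_neg α k
    have hsi := π.sign_symm i
    have hsj := π.sign_symm j
    have hsk := π.sign_symm k
    refine h ?_
    rcases hp with hp | ⟨hp, hj⟩
    · have hj : 0 < j := hb.reflect_lt (by omega)
      have hz := blockIdx_eq_zero_iff hn α hj (by omega)
      have finish : ∀ i', inPM n i' → i' < j → blockIdx α i' < blockIdx α j →
          π.perm i' = iplus (π.perm k) → π.perm i' < π.perm j → has231 α π := by
        intro i' hi' hij'' hbij hval' hlt
        refine ⟨i', j, k, ⟨hi', ⟨by omega, by omega, by omega⟩, ⟨by omega, by omega, by omega⟩,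
          hij'', hjk', hj, by omega, by omega, by omega, hval'⟩, ?_⟩
        split_ifs with hJ
        · refine ⟨fun _ => hlt, fun hle => ?_⟩
          have := hz.2 ⟨hJ, hle⟩
          omega
        · exact hlt
      by_cases hi₀ : i = 0
      · subst hi₀
        have hjk₀ := π.perm_ne (a := j) (c := -k) (by omega)
        refine finish (-k) ⟨by omega, by omega, by omega⟩ (by omega) (by omega) ?_ (by omega)
        rw [iplus, if_pos (by omega)]
        omega
      · refine finish i ⟨hi₀, by omega, by omega⟩ hij' hij ?_ (by omega)
        have hi₁ := π.perm_ne hi₀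
        rw [iplus, if_neg (by omega)]
        exact hval
    · have hz := blockIdx_eq_zero_iff hn α (x := -j) (by omega) (by omega)
      have hz' := hz.1 (by omega)
      have hi₀ : i ≠ 0 := by rintro rfl; omega
      have hk₀ : k ≠ 0 := by rintro rfl; omega
      have hk₁ := π.perm_ne hk₀
      refine ⟨-k, -j, -i, ⟨⟨by omega, by omega, by omega⟩, ⟨by omega, by omega, by omega⟩,
        ⟨by omega, by omega, by omega⟩, by omega, by omega, by omega, by omega, by omega,
        by omega, ?_⟩, ?_⟩
      · rw [iplus, if_neg (by omega)]
        omega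
      · rw [if_pos hz'.1]
        exact ⟨fun h => by omega, fun _ => by omega⟩
  · rintro h ⟨i, j, k, ⟨hi, hj, hk, hij, hjk, hj₀, hbij, hbjk, hbik, hval⟩, hpat⟩
    have hij' := lt_of_le_of_ne (hb hij.le) hbij
    have hjk' := lt_of_le_of_ne (hb hjk.le) hbjk
    have hni := blockIdx_neg α i
    have hnj := blockIdx_neg α j
    have hnk := blockIdx_neg α k
    have hsi := π.sign_symm i
    have hsj := π.sign_symm j
    have hsk := π.sign_symm k
    have hz := blockIdx_eq_zero_iff hn α hj₀ hj.2.2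
    have hbj := blockIdx_nonneg α hj₀.le
    have hcase : (0 < blockIdx α j ∧ π.perm i < π.perm j) ∨
        (blockIdx α j = 0 ∧ π.perm j < π.perm k) := by
      split_ifs at hpat with hJ
      · by_cases hle : j ≤ alpha1 α
        · exact Or.inr ⟨hz.2 ⟨hJ, hle⟩, hpat.2 hle⟩
        · refine Or.inl ⟨lt_of_le_of_ne hbj fun e => hle (hz.1 e.symm).2, hpat.1 (by omega)⟩
      · exact Or.inl ⟨lt_of_le_of_ne hbj fun e => hJ (hz.1 e.symm).1, hpat⟩
    rcases hcase with ⟨h₀, hlt⟩ | ⟨h₀, hlt⟩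
    · by_cases hk₁ : π.perm k = -1
      · rw [iplus, if_pos hk₁] at hval
        have := h 0 j k (by omega) hjk' (by omega) (Or.inl h₀)
        omega
      · rw [iplus, if_neg hk₁] at hval
        have := h i j k hij' hjk' hval (Or.inl h₀)
        omega
    · by_cases hk₁ : π.perm k = -1
      · have := hinc 0 j hj₀ (by omega)
        omega
      · rw [iplus, if_neg hk₁] at hval
        have := h (-k) (-j) (-i) (by omega) (by omega) (by omega) (Or.inr ⟨by omega, by omega⟩)
        omega

end Translation

/-- For every type-B composition `α` of `n`, the lattice
`Tam_B(α)` is semidistributive: `x ∨ y = x ∨ z` implies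
`x ∨ y = x ∨ (y ∧ z)`, and `x ∧ y = x ∧ z` implies `x ∧ y = x ∧ (y ∨ z)`. -/
theorem tamB_semidistributive (n : ℕ) (hn : 1 ≤ n) (α : BComp n) :
    (∀ x y z u m : SignedPerm n, mem231 α x → mem231 α y → mem231 α z →
      isJoinIn (Tset α) x y u → isJoinIn (Tset α) x z u →
      isMeetIn (Tset α) y z m → isJoinIn (Tset α) x m u) ∧
    (∀ x y z u m : SignedPerm n, mem231 α x → mem231 α y → mem231 α z →
      isMeetIn (Tset α) x y u → isMeetIn (Tset α) x z u →
      isJoinIn (Tset α) y z m → isMeetIn (Tset α) x m u) := by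
  have hb := blockIdx_mono hn α
  have hneg := blockIdx_neg α
  simp only [isJoinIn, isMeetIn, Tset, Set.mem_ofPred_eq, mem231_iff_aligned hn, wle_iff_below]
  refine ⟨?_, ?_⟩
  · rintro x y z u m hx hy hz ⟨hu, hxu, hyu, hxy⟩ ⟨-, -, hzu, hxz⟩ ⟨-, hmy, -, hm⟩
    exact ⟨hu, hxu, hmy.trans hyu, fun w _ hxw hmw =>
      aligned_sup_meet_le hb hneg hx hy hz hu hxu hyu hzu hxy hxz hm hxw hmw⟩
  · rintro x y z u m hx hy hz ⟨hu, hux, huy, hxy⟩ ⟨-, -, huz, hxz⟩ ⟨-, hym, -, hm⟩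
    exact ⟨hu, hux, huy.trans hym, fun w hw hwx hwm =>
      aligned_le_inf hb hneg hx hy hz hw hux huy huz hxy hxz hm hwx hwm⟩

end TypeB
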